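/- arXiv:2505.02070 — 7 statements merged into one kernel-verified Lean document; each statement's English description precedes it below -/
import Mathlib

section
/- The extended total energy E is convex on ℝ × ℝ^d × ℝ with values in [0,∞]: for all x = (ρ₁,m₁,S₁), y = (ρ₂,m₂,S₂) in ℝ × ℝ^d × ℝ and every t ∈ [0,1], one has E(t x + (1−t) y) ≤ t E(x) + (1−t) E(y), with the usual extended-real conventions for +∞. -/
open Real

open scoped ENNReal Classical

/-- The extended total energy of the polytropic Euler system, as a `[0,∞]`-valued
function of `(ρ, m, S) ∈ ℝ × ℝ^d × ℝ`. -/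
noncomputable def energyE (d : ℕ) (γ : ℝ) (x : ℝ × EuclideanSpace ℝ (Fin d) × ℝ) : ℝ≥0∞ :=
  if 0 < x.1 then
    ENNReal.ofReal
      (‖x.2.1‖ ^ 2 / (2 * x.1) + (γ - 1)⁻¹ * x.1 ^ γ * Real.exp ((γ - 1) * x.2.2 / x.1))
  else if x.1 = 0 ∧ x.2.1 = 0 ∧ x.2.2 ≤ 0 then 0
  else ⊤

/-- Convexity of the kinetic energy `‖m‖ ^ 2 / (2 ρ)` on `ρ > 0`. -/
lemma kineticEnergy_convex {V : Type*} [SeminormedAddCommGroup V] [NormedSpace ℝ V]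
    {r₁ r₂ s t : ℝ} (hr₁ : 0 < r₁) (hr₂ : 0 < r₂) (hs : 0 < s) (ht : 0 < t) (m₁ m₂ : V) :
    ‖s • m₁ + t • m₂‖ ^ 2 / (2 * (s * r₁ + t * r₂))
      ≤ s * (‖m₁‖ ^ 2 / (2 * r₁)) + t * (‖m₂‖ ^ 2 / (2 * r₂)) := by
  have hnorm : ‖s • m₁ + t • m₂‖ ≤ s * ‖m₁‖ + t * ‖m₂‖ := by
    refine (norm_add_le _ _).trans_eq ?_
    rw [norm_smul, norm_smul, Real.norm_of_nonneg hs.le, Real.norm_of_nonneg ht.le]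
  calc ‖s • m₁ + t • m₂‖ ^ 2 / (2 * (s * r₁ + t * r₂))
      ≤ (s * ‖m₁‖ + t * ‖m₂‖) ^ 2 / (2 * (s * r₁ + t * r₂)) := by gcongr
    _ ≤ s * (‖m₁‖ ^ 2 / (2 * r₁)) + t * (‖m₂‖ ^ 2 / (2 * r₂)) := by
      rw [← sub_nonneg]
      have key : s * (‖m₁‖ ^ 2 / (2 * r₁)) + t * (‖m₂‖ ^ 2 / (2 * r₂))
          - (s * ‖m₁‖ + t * ‖m₂‖) ^ 2 / (2 * (s * r₁ + t * r₂))
          = s * t * (‖m₁‖ * r₂ - ‖m₂‖ * r₁) ^ 2 / (2 * r₁ * r₂ * (s * r₁ + t * r₂)) := by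
        have : s * r₁ + t * r₂ ≠ 0 := by positivity
        field_simp
        ring
      rw [key]
      positivity

lemma rpow_mul_exp_eq_mul_exp {γ r : ℝ} (hr : 0 < r) (S : ℝ) :
    r ^ γ * exp ((γ - 1) * S / r) = r * exp ((γ - 1) * (log r + S / r)) := by
  conv_rhs => enter [1]; rw [← exp_log hr]
  rw [rpow_def_of_pos hr, ← exp_add, ← exp_add]
  congr 1
  ring

/-- Convexity of `ρ ^ γ * exp ((γ - 1) * S / ρ)` on `ρ > 0`. -/
lemma rpow_mul_exp_convex {γ r₁ r₂ s t : ℝ} (hγ : 1 ≤ γ) (hr₁ : 0 < r₁) (hr₂ : 0 < r₂)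
    (hs : 0 < s) (ht : 0 < t) (hst : s + t = 1) (S₁ S₂ : ℝ) :
    (s * r₁ + t * r₂) ^ γ * exp ((γ - 1) * (s * S₁ + t * S₂) / (s * r₁ + t * r₂))
      ≤ s * (r₁ ^ γ * exp ((γ - 1) * S₁ / r₁)) + t * (r₂ ^ γ * exp ((γ - 1) * S₂ / r₂)) := by
  have hr : 0 < s * r₁ + t * r₂ := by positivity
  rw [rpow_mul_exp_eq_mul_exp hr, rpow_mul_exp_eq_mul_exp hr₁, rpow_mul_exp_eq_mul_exp hr₂]
  set r := s * r₁ + t * r₂ with hr_def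
  have ha : 0 ≤ s * r₁ / r := by positivity
  have hb : 0 ≤ t * r₂ / r := by positivity
  have hab : s * r₁ / r + t * r₂ / r = 1 := by
    rw [← add_div, ← hr_def, div_self hr.ne']
  have hinv : s * r₁ / r * r₁⁻¹ + t * r₂ / r * r₂⁻¹ = r⁻¹ := by
    field_simp
    exact hst
  have hlog : log r ≤ s * r₁ / r * log r₁ + t * r₂ / r * log r₂ := by
    have h := strictConcaveOn_log_Ioi.concaveOn.2 (Set.mem_Ioi.2 (inv_pos.2 hr₁))
      (Set.mem_Ioi.2 (inv_pos.2 hr₂)) ha hb hab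
    simp only [smul_eq_mul] at h
    rw [hinv, log_inv, log_inv, log_inv] at h
    linarith
  have hS : (s * S₁ + t * S₂) / r = s * r₁ / r * (S₁ / r₁) + t * r₂ / r * (S₂ / r₂) := by
    field_simp
  have hexp : exp ((γ - 1) * (log r + (s * S₁ + t * S₂) / r))
      ≤ s * r₁ / r * exp ((γ - 1) * (log r₁ + S₁ / r₁))
        + t * r₂ / r * exp ((γ - 1) * (log r₂ + S₂ / r₂)) := by
    refine le_trans (exp_le_exp.2 ?_)
      (convexOn_exp.2 (Set.mem_univ _) (Set.mem_univ _) ha hb hab)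
    simp only [smul_eq_mul]
    rw [hS]
    have := mul_le_mul_of_nonneg_left hlog (sub_nonneg.2 hγ)
    linarith
  refine (mul_le_mul_of_nonneg_left hexp hr.le).trans_eq ?_
  field_simp

lemma energyE_of_pos {d : ℕ} {γ : ℝ} {x : ℝ × EuclideanSpace ℝ (Fin d) × ℝ} (hx : 0 < x.1) :
    energyE d γ x = ENNReal.ofReal
      (‖x.2.1‖ ^ 2 / (2 * x.1) + (γ - 1)⁻¹ * x.1 ^ γ * exp ((γ - 1) * x.2.2 / x.1)) :=
  if_pos hx

lemma energyE_of_vacuum {d : ℕ} {γ : ℝ} {x : ℝ × EuclideanSpace ℝ (Fin d) × ℝ}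
    (hx : x.1 = 0 ∧ x.2.1 = 0 ∧ x.2.2 ≤ 0) : energyE d γ x = 0 := by
  rw [energyE, if_neg hx.1.not_gt, if_pos hx]

lemma energyE_eq_top {d : ℕ} {γ : ℝ} {x : ℝ × EuclideanSpace ℝ (Fin d) × ℝ}
    (hx : ¬ 0 < x.1) (hx' : ¬ (x.1 = 0 ∧ x.2.1 = 0 ∧ x.2.2 ≤ 0)) : energyE d γ x = ⊤ := by
  rw [energyE, if_neg hx, if_neg hx']

/-- Convexity of the energy along segments between two states of positive density. -/
lemma energyE_convex_of_pos {d : ℕ} {γ : ℝ} (hγ : 1 < γ)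
    {x y : ℝ × EuclideanSpace ℝ (Fin d) × ℝ} (hx : 0 < x.1) (hy : 0 < y.1) {s t : ℝ}
    (hs : 0 < s) (ht : 0 < t) (hst : s + t = 1) :
    energyE d γ (s • x + t • y)
      ≤ ENNReal.ofReal s * energyE d γ x + ENNReal.ofReal t * energyE d γ y := by
  obtain ⟨r₁, m₁, S₁⟩ := x
  obtain ⟨r₂, m₂, S₂⟩ := y
  dsimp only at hx hy
  have hγ' : 0 < γ - 1 := sub_pos.2 hγ
  have hr : 0 < s * r₁ + t * r₂ := by positivity
  rw [energyE_of_pos (x := (r₁, m₁, S₁)) hx, energyE_of_pos (x := (r₂, m₂, S₂)) hy,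
    energyE_of_pos (by simpa using hr), ← ENNReal.ofReal_mul hs.le, ← ENNReal.ofReal_mul ht.le,
    ← ENNReal.ofReal_add (by positivity) (by positivity)]
  apply ENNReal.ofReal_le_ofReal
  simp only [Prod.smul_mk, Prod.mk_add_mk, smul_eq_mul]
  have hkin := kineticEnergy_convex hx hy hs ht m₁ m₂
  have hint := mul_le_mul_of_nonneg_left
    (rpow_mul_exp_convex hγ.le hx hy hs ht hst S₁ S₂) (inv_pos.2 hγ').le
  linarith

/-- Convexity of the energy along segments ending in the vacuum. -/
lemma energyE_smul_add_vacuum_le {d : ℕ} {γ : ℝ} (hγ : 1 < γ)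
    {x z : ℝ × EuclideanSpace ℝ (Fin d) × ℝ} (hx : 0 < x.1)
    (hz : z.1 = 0 ∧ z.2.1 = 0 ∧ z.2.2 ≤ 0) {s t : ℝ} (hs : 0 < s) (hs1 : s ≤ 1) (ht : 0 ≤ t) :
    energyE d γ (s • x + t • z) ≤ ENNReal.ofReal s * energyE d γ x := by
  obtain ⟨r, m, S⟩ := x
  obtain ⟨r₀, m₀, S₀⟩ := z
  dsimp only at hx hz
  obtain ⟨rfl, rfl, hS₀⟩ := hz
  have hγ' : 0 < γ - 1 := sub_pos.2 hγ
  have hr : 0 < s * r := by positivity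
  rw [energyE_of_pos (x := (r, m, S)) hx, energyE_of_pos (by simpa using hr),
    ← ENNReal.ofReal_mul hs.le]
  apply ENNReal.ofReal_le_ofReal
  simp only [Prod.smul_mk, Prod.mk_add_mk, smul_eq_mul, smul_zero, mul_zero, add_zero]
  have hkin : ‖s • m‖ ^ 2 / (2 * (s * r)) = s * (‖m‖ ^ 2 / (2 * r)) := by
    rw [norm_smul, Real.norm_of_nonneg hs.le]
    field_simp
  have hpow : (s * r) ^ γ ≤ s * r ^ γ := by
    rw [mul_rpow hs.le hx.le]
    gcongr
    exact (rpow_le_rpow_of_exponent_ge hs hs1 hγ.le).trans_eq (rpow_one s)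
  have hexp : exp ((γ - 1) * (s * S + t * S₀) / (s * r)) ≤ exp ((γ - 1) * S / r) := by
    have hle : s * S + t * S₀ ≤ s * S := by
      linarith [mul_nonpos_of_nonneg_of_nonpos ht hS₀]
    have heq : (γ - 1) * S / r = (γ - 1) * (s * S) / (s * r) := by field_simp
    rw [heq]
    gcongr
  have hint : (γ - 1)⁻¹ * (s * r) ^ γ * exp ((γ - 1) * (s * S + t * S₀) / (s * r))
      ≤ (γ - 1)⁻¹ * (s * r ^ γ) * exp ((γ - 1) * S / r) := by gcongr
  linarith

/-- The extended total energy is convex on `ℝ × ℝ^d × ℝ` with values in `[0,∞]`. -/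
theorem energyE_convex (d : ℕ) (hd : 1 ≤ d) (γ : ℝ) (hγ : 1 < γ)
    (x y : ℝ × EuclideanSpace ℝ (Fin d) × ℝ) (t : ℝ) (ht0 : 0 ≤ t) (ht1 : t ≤ 1) :
    energyE d γ (t • x + (1 - t) • y)
      ≤ ENNReal.ofReal t * energyE d γ x + ENNReal.ofReal (1 - t) * energyE d γ y := by
  rcases ht0.eq_or_lt with rfl | ht
  · simp
  rcases ht1.eq_or_lt with rfl | ht'
  · simp
  have hs : 0 < 1 - t := sub_pos.2 ht'
  by_cases hx : 0 < x.1
  · by_cases hy : 0 < y.1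
    · exact energyE_convex_of_pos hγ hx hy ht hs (by ring)
    by_cases hy' : y.1 = 0 ∧ y.2.1 = 0 ∧ y.2.2 ≤ 0
    · exact (energyE_smul_add_vacuum_le hγ hx hy' ht ht1 hs.le).trans le_self_add
    · simp [energyE_eq_top hy hy', ENNReal.mul_top, ht']
  by_cases hx' : x.1 = 0 ∧ x.2.1 = 0 ∧ x.2.2 ≤ 0
  · by_cases hy : 0 < y.1
    · rw [add_comm (t • x)]
      exact (energyE_smul_add_vacuum_le hγ hy hx' hs (by linarith) ht.le).trans le_add_self
    by_cases hy' : y.1 = 0 ∧ y.2.1 = 0 ∧ y.2.2 ≤ 0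
    · rw [energyE_of_vacuum]
      · exact zero_le
      · refine ⟨by simp [hx'.1, hy'.1], by simp [hx'.2.1, hy'.2.1], ?_⟩
        exact add_nonpos (mul_nonpos_of_nonneg_of_nonpos ht.le hx'.2.2)
          (mul_nonpos_of_nonneg_of_nonpos hs.le hy'.2.2)
    · simp [energyE_eq_top hy hy', ENNReal.mul_top, ht']
  · simp [energyE_eq_top hx hx', ENNReal.mul_top, ht]
end

section
/- (Thermodynamic stability.) The extended total energy E is strictly convex on the open convex set {(ρ, m, S) ∈ ℝ × ℝ^d × ℝ : ρ > 0}, where it is finite: for any two distinct points x ≠ y of this set and any t ∈ (0,1), E(t x + (1−t) y) < t E(x) + (1−t) E(y). -/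
open Real

open scoped ENNReal Classical

/-- The real-valued total energy, which agrees with `energyE` at positive density. -/
noncomputable def realEnergy (d : ℕ) (γ : ℝ) (x : ℝ × EuclideanSpace ℝ (Fin d) × ℝ) : ℝ :=
  ‖x.2.1‖ ^ 2 / (2 * x.1) + (γ - 1)⁻¹ * x.1 ^ γ * Real.exp ((γ - 1) * x.2.2 / x.1)

theorem energyE_of_pos_s2 {d : ℕ} {γ : ℝ} {x : ℝ × EuclideanSpace ℝ (Fin d) × ℝ} (hx : 0 < x.1) :
    energyE d γ x = ENNReal.ofReal (realEnergy d γ x) :=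
  if_pos hx

theorem realEnergy_pos {d : ℕ} {γ : ℝ} (hγ : 1 < γ) {x : ℝ × EuclideanSpace ℝ (Fin d) × ℝ}
    (hx : 0 < x.1) : 0 < realEnergy d γ x := by
  have hc : 0 < γ - 1 := sub_pos.2 hγ
  unfold realEnergy
  positivity

theorem sub_one_le_mul_log {r : ℝ} (hr : 0 < r) : r - 1 ≤ r * log r := by
  have h := mul_le_mul_of_nonneg_left (one_sub_inv_le_log_of_pos hr) hr.le
  rwa [mul_sub, mul_one, mul_inv_cancel₀ hr.ne'] at h

theorem sub_one_lt_mul_log {r : ℝ} (hr : 0 < r) (hr1 : r ≠ 1) : r - 1 < r * log r := by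
  have h := log_lt_sub_one_of_pos (inv_pos.2 hr) (inv_ne_one.2 hr1)
  rw [log_inv] at h
  have h' := mul_lt_mul_of_pos_left h hr
  rw [mul_sub, mul_one, mul_inv_cancel₀ hr.ne'] at h'
  linarith

/-- The tangent inequality for the internal energy, relative to a base point, in terms of the
density ratio `r` and the difference `a` of specific entropies. -/
theorem tangent_le_rpow_mul_exp {γ r : ℝ} (hγ : 1 < γ) (hr : 0 < r) (a : ℝ) :
    1 + γ * (r - 1) + (γ - 1) * r * a ≤ r ^ γ * exp ((γ - 1) * a) ∧
      (r ≠ 1 ∨ a ≠ 0 →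
        1 + γ * (r - 1) + (γ - 1) * r * a < r ^ γ * exp ((γ - 1) * a)) := by
  have hc : 0 < γ - 1 := sub_pos.2 hγ
  have hexp : r ^ γ * exp ((γ - 1) * a) = r * exp ((γ - 1) * (log r + a)) := by
    rw [rpow_def_of_pos hr, ← exp_add]
    nth_rewrite 2 [← exp_log hr]
    rw [← exp_add]
    ring_nf
  have hle := mul_le_mul_of_nonneg_left (add_one_le_exp ((γ - 1) * (log r + a))) hr.le
  have hlog := mul_le_mul_of_nonneg_left (sub_one_le_mul_log hr) hc.le
  rw [hexp]
  refine ⟨by linarith, fun h => ?_⟩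
  by_cases hr1 : r = 1
  · subst hr1
    have ha : a ≠ 0 := h.resolve_left (by simp)
    have := add_one_lt_exp (mul_ne_zero hc.ne' ha)
    simp only [log_one, zero_add]
    linarith
  · have := mul_lt_mul_of_pos_left (sub_one_lt_mul_log hr hr1) hc
    linarith

theorem internal_energy_eq {γ ρ ρ₀ : ℝ} (hρ : 0 < ρ) (hρ₀ : 0 < ρ₀) (S S₀ : ℝ) :
    ρ ^ γ * exp ((γ - 1) * S / ρ) = ρ₀ ^ γ * exp ((γ - 1) * S₀ / ρ₀) *
      ((ρ / ρ₀) ^ γ * exp ((γ - 1) * (S / ρ - S₀ / ρ₀))) := by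
  have h : (γ - 1) * S / ρ = (γ - 1) * S₀ / ρ₀ + (γ - 1) * (S / ρ - S₀ / ρ₀) := by ring
  rw [h, exp_add, div_rpow hρ.le hρ₀.le]
  have := (rpow_pos_of_pos hρ₀ γ).ne'
  field_simp

theorem kinetic_energy_sub_tangent {V : Type*} [NormedAddCommGroup V] [InnerProductSpace ℝ V]
    {ρ ρ₀ : ℝ} (hρ : 0 < ρ) (hρ₀ : 0 < ρ₀) (m m₀ : V) :
    ‖m‖ ^ 2 / (2 * ρ) - (‖m₀‖ ^ 2 / (2 * ρ₀) + ρ₀⁻¹ * inner ℝ m₀ (m - m₀)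
        - ‖m₀‖ ^ 2 / (2 * ρ₀ ^ 2) * (ρ - ρ₀)) =
      ‖m - (ρ / ρ₀) • m₀‖ ^ 2 / (2 * ρ) := by
  rw [norm_sub_sq_real, inner_smul_right, norm_smul, inner_sub_right, real_inner_self_eq_norm_sq,
    real_inner_comm m m₀, mul_pow, Real.norm_eq_abs, sq_abs]
  field_simp
  ring

/-- At positive density, the graph of the energy lies strictly above its tangent hyperplanes. -/
theorem exists_tangent_lt_realEnergy {d : ℕ} {γ : ℝ} (hγ : 1 < γ)
    {z : ℝ × EuclideanSpace ℝ (Fin d) × ℝ} (hz : 0 < z.1) :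
    ∃ L : ℝ × EuclideanSpace ℝ (Fin d) × ℝ →ₗ[ℝ] ℝ, ∀ x : ℝ × EuclideanSpace ℝ (Fin d) × ℝ,
      0 < x.1 → x ≠ z → realEnergy d γ z + L (x - z) < realEnergy d γ x := by
  obtain ⟨ρ₀, m₀, S₀⟩ := z
  dsimp only at hz
  have hc : 0 < γ - 1 := sub_pos.2 hγ
  set K : ℝ := (γ - 1)⁻¹ * (ρ₀ ^ γ * exp ((γ - 1) * S₀ / ρ₀)) with hK
  have hKpos : 0 < K := by positivity
  refine ⟨(K * (γ - (γ - 1) * (S₀ / ρ₀)) / ρ₀ - ‖m₀‖ ^ 2 / (2 * ρ₀ ^ 2)) • LinearMap.fst ℝ _ _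
    + ρ₀⁻¹ • ((innerₛₗ ℝ m₀) ∘ₗ LinearMap.fst ℝ _ _ ∘ₗ LinearMap.snd ℝ _ _)
    + (K * (γ - 1) / ρ₀) • (LinearMap.snd ℝ _ _ ∘ₗ LinearMap.snd ℝ _ _), ?_⟩
  rintro ⟨ρ, m, S⟩ hρ hne
  dsimp only at hρ
  have hr : 0 < ρ / ρ₀ := div_pos hρ hz
  have hkin := kinetic_energy_sub_tangent hρ hz m m₀
  obtain ⟨hle, hlt⟩ := tangent_le_rpow_mul_exp hγ hr (S / ρ - S₀ / ρ₀)
  have hlin : K * (1 + γ * (ρ / ρ₀ - 1) + (γ - 1) * (ρ / ρ₀) * (S / ρ - S₀ / ρ₀)) =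
      K + K * (γ - (γ - 1) * (S₀ / ρ₀)) / ρ₀ * (ρ - ρ₀) + K * (γ - 1) / ρ₀ * (S - S₀) := by
    field_simp
    ring
  have hint : (γ - 1)⁻¹ * ρ ^ γ * exp ((γ - 1) * S / ρ) =
      K * ((ρ / ρ₀) ^ γ * exp ((γ - 1) * (S / ρ - S₀ / ρ₀))) := by
    rw [mul_assoc, internal_energy_eq hρ hz S S₀, hK]
    ring
  have hint₀ : (γ - 1)⁻¹ * ρ₀ ^ γ * exp ((γ - 1) * S₀ / ρ₀) = K := by rw [hK, mul_assoc]
  simp only [realEnergy, LinearMap.add_apply, LinearMap.smul_apply, LinearMap.comp_apply,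
    LinearMap.fst_apply, LinearMap.snd_apply, innerₛₗ_apply_apply, smul_eq_mul, Prod.fst_sub,
    Prod.snd_sub, hint, hint₀]
  have hsq : 0 ≤ ‖m - (ρ / ρ₀) • m₀‖ ^ 2 / (2 * ρ) := by positivity
  by_cases h : ρ / ρ₀ ≠ 1 ∨ S / ρ - S₀ / ρ₀ ≠ 0
  · have := mul_lt_mul_of_pos_left (hlt h) hKpos
    linarith
  · push Not at h
    obtain ⟨hr1, hs⟩ := h
    have hρeq : ρ = ρ₀ := (div_eq_one_iff_eq hz.ne').1 hr1
    have hS : S = S₀ := by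
      rw [hρeq, ← sub_div, div_eq_zero_iff, or_iff_left hz.ne'] at hs
      exact sub_eq_zero.1 hs
    have hm : m ≠ m₀ := fun hm => hne (by rw [hρeq, hS, hm])
    have hsq' : 0 < ‖m - (ρ / ρ₀) • m₀‖ ^ 2 / (2 * ρ) := by
      rw [hr1, one_smul]
      have := norm_pos_iff.2 (sub_ne_zero.2 hm)
      positivity
    have := mul_le_mul_of_nonneg_left hle hKpos.le
    linarith

/-- Thermodynamic stability: the extended total energy is strictly convex on the open
convex set `{(ρ, m, S) : ρ > 0}`, where it is finite. -/
theorem energyE_strictConvexOn (d : ℕ) (hd : 1 ≤ d) (γ : ℝ) (hγ : 1 < γ)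
    (x y : ℝ × EuclideanSpace ℝ (Fin d) × ℝ) (hx : 0 < x.1) (hy : 0 < y.1) (hxy : x ≠ y)
    (t : ℝ) (ht0 : 0 < t) (ht1 : t < 1) :
    energyE d γ (t • x + (1 - t) • y)
      < ENNReal.ofReal t * energyE d γ x + ENNReal.ofReal (1 - t) * energyE d γ y := by
  have hs : 0 < 1 - t := sub_pos.2 ht1
  set z := t • x + (1 - t) • y with hzdef
  have hz : 0 < z.1 := by
    simp only [hzdef, Prod.fst_add, Prod.smul_fst, smul_eq_mul]
    positivity
  have hxz : x - z = (1 - t) • (x - y) := by rw [hzdef]; module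
  have hyz : y - z = (-t) • (x - y) := by rw [hzdef]; module
  have hsub : x - y ≠ 0 := sub_ne_zero.2 hxy
  obtain ⟨L, hL⟩ := exists_tangent_lt_realEnergy hγ hz
  have h1 := hL x hx (sub_ne_zero.1 (hxz ▸ smul_ne_zero hs.ne' hsub))
  have h2 := hL y hy (sub_ne_zero.1 (hyz ▸ smul_ne_zero (neg_ne_zero.2 ht0.ne') hsub))
  rw [hxz, map_smul, smul_eq_mul] at h1
  rw [hyz, map_smul, smul_eq_mul] at h2
  have hEx := realEnergy_pos hγ hx
  have hEy := realEnergy_pos hγ hy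
  rw [energyE_of_pos_s2 hx, energyE_of_pos_s2 hy, energyE_of_pos_s2 hz, ← ENNReal.ofReal_mul ht0.le,
    ← ENNReal.ofReal_mul hs.le, ← ENNReal.ofReal_add (by positivity) (by positivity),
    ENNReal.ofReal_lt_ofReal_iff (by positivity)]
  linarith [mul_lt_mul_of_pos_left h1 ht0, mul_lt_mul_of_pos_left h2 hs]
end

section
/- The internal energy density h(ρ, S) = (γ−1)⁻¹ ρ^γ exp((γ−1)S/ρ) is strictly convex on the open half-plane (0,∞) × ℝ: for any two distinct points (ρ₁,S₁) ≠ (ρ₂,S₂) with ρ₁, ρ₂ > 0 and any t ∈ (0,1), h(t(ρ₁,S₁) + (1−t)(ρ₂,S₂)) < t h(ρ₁,S₁) + (1−t) h(ρ₂,S₂). -/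
open Real

/-- The internal energy density `h(ρ, S) = (γ−1)⁻¹ ρ^γ exp((γ−1)S/ρ)` of the
polytropic Euler system. -/
noncomputable def internalEnergy (γ : ℝ) (p : ℝ × ℝ) : ℝ :=
  (γ - 1)⁻¹ * p.1 ^ γ * Real.exp ((γ - 1) * p.2 / p.1)

/-- The strict tangent inequality behind the convexity of `x ^ γ * exp ((γ - 1) * d)`. -/
theorem affine_lt_rpow_mul_exp {γ x d : ℝ} (hγ : 1 < γ) (hx : 0 < x) (h : x ≠ 1 ∨ d ≠ 0) :
    1 + γ * (x - 1) + (γ - 1) * (x * d) < x ^ γ * exp ((γ - 1) * d) := by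
  have ha : 0 < γ - 1 := sub_pos.2 hγ
  have hpow : x ^ γ * exp ((γ - 1) * d) = x * exp ((γ - 1) * (log x + d)) := by
    nth_rewrite 2 [← exp_log hx]
    rw [rpow_def_of_pos hx, ← exp_add, ← exp_add]
    ring_nf
  have hlin : 1 + γ * (x - 1) + (γ - 1) * (x * d) =
      x * ((γ - 1) * (1 - x⁻¹) + (γ - 1) * d + 1) := by
    field_simp
    ring
  rw [hpow, hlin]
  refine mul_lt_mul_of_pos_left ?_ hx
  by_cases hx1 : x = 1
  · have hd : d ≠ 0 := h.resolve_left (not_not.2 hx1)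
    simpa [hx1] using add_one_lt_exp (mul_ne_zero ha.ne' hd)
  · have hlog : 1 - x⁻¹ < log x := by
      have := log_lt_sub_one_of_pos (inv_pos.2 hx) (inv_ne_one.2 hx1)
      rw [log_inv] at this
      linarith
    have := add_one_le_exp ((γ - 1) * (log x + d))
    linarith [mul_lt_mul_of_pos_left hlog ha]

/-- The internal energy density lies strictly above its tangent plane at `m`, away from `m`. -/
theorem tangent_lt_internalEnergy {γ : ℝ} (hγ : 1 < γ) {m p : ℝ × ℝ} (hm : 0 < m.1)
    (hp : 0 < p.1) (hne : p ≠ m) :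
    internalEnergy γ m *
        (1 + γ * (p.1 / m.1 - 1) + (γ - 1) * ((p.2 - m.2 / m.1 * p.1) / m.1)) <
      internalEnergy γ p := by
  have ha : 0 < γ - 1 := sub_pos.2 hγ
  have hpos : 0 < internalEnergy γ m := by
    unfold internalEnergy
    positivity
  have hxd : p.1 / m.1 ≠ 1 ∨ p.2 / p.1 - m.2 / m.1 ≠ 0 := by
    by_contra! hcon
    have h1 : p.1 = m.1 := (div_eq_one_iff_eq hm.ne').1 hcon.1
    have h2 := hcon.2
    rw [h1, sub_eq_zero, div_left_inj' hm.ne'] at h2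
    exact hne (Prod.ext h1 h2)
  have key := mul_lt_mul_of_pos_left
    (affine_lt_rpow_mul_exp hγ (div_pos hp hm) hxd) hpos
  have hlin : p.1 / m.1 * (p.2 / p.1 - m.2 / m.1) = (p.2 - m.2 / m.1 * p.1) / m.1 := by
    field_simp
  have hval : internalEnergy γ m *
      ((p.1 / m.1) ^ γ * exp ((γ - 1) * (p.2 / p.1 - m.2 / m.1))) = internalEnergy γ p := by
    have hexp : exp ((γ - 1) * p.2 / p.1) = exp ((γ - 1) * m.2 / m.1) *
        exp ((γ - 1) * (p.2 / p.1 - m.2 / m.1)) := by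
      rw [← exp_add]
      ring_nf
    have hrpow : m.1 ^ γ ≠ 0 := (rpow_pos_of_pos hm γ).ne'
    unfold internalEnergy
    rw [hexp, div_rpow hp.le hm.le]
    field_simp
  rwa [hlin, hval] at key

/-- The internal energy density is strictly convex on the open half-plane `(0,∞) × ℝ`. -/
theorem internalEnergy_strictConvexOn (γ : ℝ) (hγ : 1 < γ)
    (p q : ℝ × ℝ) (hp : 0 < p.1) (hq : 0 < q.1) (hpq : p ≠ q)
    (t : ℝ) (ht0 : 0 < t) (ht1 : t < 1) :
    internalEnergy γ (t • p + (1 - t) • q)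
      < t * internalEnergy γ p + (1 - t) * internalEnergy γ q := by
  have hm : 0 < (t • p + (1 - t) • q).1 := by
    have := sub_pos.2 ht1
    simp only [Prod.fst_add, Prod.smul_fst, smul_eq_mul]
    positivity
  have hpm : p ≠ t • p + (1 - t) • q := by
    intro h
    have h' : (1 - t) • (p - q) = 0 := by
      rw [smul_sub, sub_eq_zero, sub_smul, one_smul]
      exact sub_eq_of_eq_add' h
    exact (smul_ne_zero (sub_pos.2 ht1).ne' (sub_ne_zero.2 hpq)) h'
  have hqm : q ≠ t • p + (1 - t) • q := by
    intro h
    have h' : t • (p - q) = 0 := by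
      rw [smul_sub, sub_eq_zero]
      rw [sub_smul, one_smul] at h
      exact add_right_cancel (b := q - t • q) (by rw [← h]; abel)
    exact (smul_ne_zero ht0.ne' (sub_ne_zero.2 hpq)) h'
  have hp' := mul_lt_mul_of_pos_left (tangent_lt_internalEnergy hγ hm hp hpm) ht0
  have hq' := mul_lt_mul_of_pos_left (tangent_lt_internalEnergy hγ hm hq hqm) (sub_pos.2 ht1)
  have h1 : (t • p + (1 - t) • q).1 = t * p.1 + (1 - t) * q.1 := by simp
  have h2 : (t • p + (1 - t) • q).2 = t * p.2 + (1 - t) * q.2 := by simp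
  generalize t • p + (1 - t) • q = m at *
  refine lt_of_eq_of_lt ?_ (add_lt_add hp' hq')
  have hsum : t * (1 + γ * (p.1 / m.1 - 1) + (γ - 1) * ((p.2 - m.2 / m.1 * p.1) / m.1)) +
      (1 - t) * (1 + γ * (q.1 / m.1 - 1) + (γ - 1) * ((q.2 - m.2 / m.1 * q.1) / m.1)) = 1 := by
    have e1 : t * (p.1 / m.1) + (1 - t) * (q.1 / m.1) = 1 := by
      rw [← mul_div_assoc, ← mul_div_assoc, ← add_div, ← h1, div_self hm.ne']
    have e2 : t * (p.2 / m.1) + (1 - t) * (q.2 / m.1) = m.2 / m.1 := by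
      rw [← mul_div_assoc, ← mul_div_assoc, ← add_div, ← h2]
    linear_combination (γ - (γ - 1) * (m.2 / m.1)) * e1 + (γ - 1) * e2
  linear_combination -internalEnergy γ m * hsum
end

section
/- (Coercivity under the entropy minimum principle.) For every real γ > 1, every integer d ≥ 1 and every real s̲, there exists a constant C > 0 such that for all ρ > 0, all m ∈ ℝ^d and all S ∈ ℝ with S ≥ s̲ ρ, one has ρ^γ + |S|^γ + |m|^{2γ/(γ+1)} ≤ C · ( |m|²/(2ρ) + (γ−1)⁻¹ ρ^γ exp((γ−1)S/ρ) ). -/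
/-- Exponential growth dominates power growth on a half-line bounded below. -/
lemma abs_rpow_le_mul_exp {a p b s : ℝ} (ha : 0 < a) (hp : 0 < p) (hs : b ≤ s) :
    |s| ^ p ≤ (p / a) ^ p * Real.exp (2 * a * |b|) * Real.exp (a * s) := by
  have h1 : |s| ≤ p / a * Real.exp (a / p * |s|) := by
    have h := (le_add_of_nonneg_right zero_le_one).trans (Real.add_one_le_exp (a / p * |s|))
    calc |s| = p / a * (a / p * |s|) := by field_simp
      _ ≤ _ := by gcongr
  have h2 : |s| ≤ s + 2 * |b| := by
    rcases abs_cases s with ⟨h, _⟩ | ⟨h, _⟩ <;> rw [h] <;>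
      linarith [neg_abs_le b, abs_nonneg b]
  calc |s| ^ p ≤ (p / a * Real.exp (a / p * |s|)) ^ p := by gcongr
    _ = (p / a) ^ p * Real.exp (a * |s|) := by
      rw [Real.mul_rpow (by positivity) (by positivity), ← Real.exp_mul]
      congr 2
      field_simp
    _ ≤ (p / a) ^ p * Real.exp (2 * a * |b| + a * s) := by
      gcongr
      nlinarith
    _ = _ := by rw [Real.exp_add, ← mul_assoc]

/-- Young's inequality bounding a power of the momentum by kinetic energy and density. -/
lemma rpow_le_sq_div_add_rpow {p r x : ℝ} (hp : 0 < p) (hr : 0 < r) (hx : 0 ≤ x) :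
    x ^ (2 * p / (p + 1)) ≤ x ^ 2 / r + r ^ p := by
  have hq : 0 < p + 1 := by linarith
  have h := Real.geom_mean_le_arith_mean2_weighted (w₁ := p / (p + 1)) (w₂ := 1 / (p + 1))
    (p₁ := x ^ 2 / r) (p₂ := r ^ p) (by positivity) (by positivity) (by positivity)
    (by positivity) (by field_simp)
  have e : (x ^ 2 / r) ^ (p / (p + 1)) * (r ^ p) ^ (1 / (p + 1)) = x ^ (2 * p / (p + 1)) := by
    rw [Real.div_rpow (by positivity) hr.le, ← Real.rpow_natCast x 2, ← Real.rpow_mul hx,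
      ← Real.rpow_mul hr.le, mul_one_div, div_mul_cancel₀ _ (by positivity), Nat.cast_ofNat,
      mul_div_assoc]
  rw [e] at h
  refine h.trans (add_le_add ?_ ?_)
  · exact mul_le_of_le_one_left (by positivity) ((div_le_one hq).2 (by linarith))
  · exact mul_le_of_le_one_left (by positivity) ((div_le_one hq).2 (by linarith))

/-- Coercivity of the total energy of the polytropic Euler system under the entropy
minimum principle `S ≥ s̲ ρ`: the quantities `ρ^γ`, `|S|^γ` and `|m|^{2γ/(γ+1)}` are
dominated by a fixed multiple of the total energy. -/
theorem energy_coercive (γ : ℝ) (hγ : 1 < γ) (d : ℕ) (hd : 1 ≤ d) (sbar : ℝ) :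
    ∃ C : ℝ, 0 < C ∧
      ∀ (ρ : ℝ) (m : EuclideanSpace ℝ (Fin d)) (S : ℝ), 0 < ρ → sbar * ρ ≤ S →
        ρ ^ γ + |S| ^ γ + ‖m‖ ^ (2 * γ / (γ + 1))
          ≤ C * (‖m‖ ^ 2 / (2 * ρ) + (γ - 1)⁻¹ * ρ ^ γ * Real.exp ((γ - 1) * S / ρ)) := by
  have ha : 0 < γ - 1 := by linarith
  have hγ0 : 0 < γ := by linarith
  set A := Real.exp (-((γ - 1) * sbar)) with hA
  set B := (γ / (γ - 1)) ^ γ * Real.exp (2 * (γ - 1) * |sbar|)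
  have hA0 : 0 < A := by positivity
  have hB0 : 0 < B := by positivity
  refine ⟨2 + (γ - 1) * (2 * A + B), by positivity, fun ρ m S hρ hS => ?_⟩
  have hs : sbar ≤ S / ρ := (le_div_iff₀ hρ).2 hS
  rw [mul_div_assoc (γ - 1) S ρ]
  set X := Real.exp ((γ - 1) * (S / ρ)) with hX
  have hX0 : 0 < X := by positivity
  have h1 : ρ ^ γ ≤ A * (ρ ^ γ * X) := by
    have : 1 ≤ A * X := by
      rw [hA, hX, ← Real.exp_add]
      exact Real.one_le_exp (by nlinarith)
    calc ρ ^ γ ≤ ρ ^ γ * (A * X) := le_mul_of_one_le_right (by positivity) this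
      _ = _ := by ring
  have h2 : |S| ^ γ ≤ B * (ρ ^ γ * X) := by
    have e : |S| = ρ * |S / ρ| := by
      rw [abs_div, abs_of_pos hρ, mul_div_cancel₀ _ hρ.ne']
    calc |S| ^ γ = ρ ^ γ * |S / ρ| ^ γ := by rw [e, Real.mul_rpow hρ.le (abs_nonneg _)]
      _ ≤ ρ ^ γ * (B * X) := by
        gcongr
        exact abs_rpow_le_mul_exp ha hγ0 hs
      _ = _ := by ring
  have h3 := rpow_le_sq_div_add_rpow hγ0 hρ (norm_nonneg m)
  have e : (2 + (γ - 1) * (2 * A + B)) * (‖m‖ ^ 2 / (2 * ρ) + (γ - 1)⁻¹ * ρ ^ γ * X)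
      = ‖m‖ ^ 2 / ρ + (2 * A + B) * (ρ ^ γ * X)
        + ((γ - 1) * (2 * A + B) * (‖m‖ ^ 2 / (2 * ρ)) + 2 * ((γ - 1)⁻¹ * ρ ^ γ * X)) := by
    field_simp
    ring
  have h4 : 0 ≤ (γ - 1) * (2 * A + B) * (‖m‖ ^ 2 / (2 * ρ)) + 2 * ((γ - 1)⁻¹ * ρ ^ γ * X) := by
    positivity
  rw [e]
  linarith
end

section
/- The entropy σ is strictly concave on the open convex set D = {(ρ, m, E) ∈ ℝ × ℝ^d × ℝ : ρ > 0 and E > |m|²/(2ρ)}: for any two distinct points x ≠ y of D and any t ∈ (0,1), σ(t x + (1−t) y) > t σ(x) + (1−t) σ(y). -/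
open Real

/-- The entropy of the polytropic Euler system in the conservative variables
`(ρ, m, E)`: `σ(ρ, m, E) = c_v ρ log((γ−1)(E − |m|²/(2ρ)) ρ^{−γ})` with
`c_v = 1/(γ−1)`. -/
noncomputable def entropyCons (d : ℕ) (γ : ℝ) (x : ℝ × EuclideanSpace ℝ (Fin d) × ℝ) : ℝ :=
  (γ - 1)⁻¹ * x.1 * Real.log ((γ - 1) * (x.2.2 - ‖x.2.1‖ ^ 2 / (2 * x.1)) * x.1 ^ (-γ))

/-- The deficit in the convexity of `(ρ, m) ↦ |m|²/(2ρ)` along a segment. -/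
theorem kineticEnergy_convexity_deficit {V : Type*} [NormedAddCommGroup V] [InnerProductSpace ℝ V]
    (u v : V) {a b s t : ℝ} (ha : 0 < a) (hb : 0 < b) (ht : 0 < t) (hs : 0 < s) :
    t * (‖u‖ ^ 2 / (2 * a)) + s * (‖v‖ ^ 2 / (2 * b))
        - ‖t • u + s • v‖ ^ 2 / (2 * (t * a + s * b))
      = t * s * ‖b • u - a • v‖ ^ 2 / (2 * a * b * (t * a + s * b)) := by
  have hc : t * a + s * b ≠ 0 := by positivity
  rw [norm_add_sq_real, norm_sub_sq_real]
  simp only [norm_smul, real_inner_smul_left, real_inner_smul_right, mul_pow, Real.norm_eq_abs,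
    sq_abs]
  field_simp
  ring

/-- The perspective `(ρ, e) ↦ ρ log (e / ρ)` of the logarithm is concave. -/
theorem mul_log_div_add_le {a b e f s t : ℝ} (ha : 0 < a) (hb : 0 < b) (he : 0 < e) (hf : 0 < f)
    (ht : 0 < t) (hs : 0 < s) :
    t * (a * log (e / a)) + s * (b * log (f / b))
      ≤ (t * a + s * b) * log ((t * e + s * f) / (t * a + s * b)) := by
  have hc : 0 < t * a + s * b := by positivity
  have h := strictConcaveOn_log_Ioi.concaveOn.2 (Set.mem_Ioi.2 (div_pos he ha))
    (Set.mem_Ioi.2 (div_pos hf hb)) (show 0 ≤ t * a / (t * a + s * b) by positivity)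
    (show 0 ≤ s * b / (t * a + s * b) by positivity) (by field_simp)
  simp only [smul_eq_mul] at h
  calc t * (a * log (e / a)) + s * (b * log (f / b))
      = (t * a + s * b) * (t * a / (t * a + s * b) * log (e / a)
          + s * b / (t * a + s * b) * log (f / b)) := by field_simp
    _ ≤ (t * a + s * b) * log (t * a / (t * a + s * b) * (e / a)
          + s * b / (t * a + s * b) * (f / b)) := mul_le_mul_of_nonneg_left h hc.le
    _ = _ := by congr 2; field_simp

theorem entropyCons_eq {d : ℕ} {γ : ℝ} (hγ : 1 < γ) {x : ℝ × EuclideanSpace ℝ (Fin d) × ℝ}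
    (hx : 0 < x.1 ∧ ‖x.2.1‖ ^ 2 / (2 * x.1) < x.2.2) :
    entropyCons d γ x = (γ - 1)⁻¹ * log (γ - 1) * x.1
      + (γ - 1)⁻¹ * (x.1 * log ((x.2.2 - ‖x.2.1‖ ^ 2 / (2 * x.1)) / x.1)) - x.1 * log x.1 := by
  have hg : γ - 1 ≠ 0 := (sub_pos.2 hγ).ne'
  have he := (sub_pos.2 hx.2).ne'
  rw [entropyCons, log_mul (mul_ne_zero hg he) (rpow_pos_of_pos hx.1 _).ne', log_mul hg he,
    log_rpow hx.1, log_div he hx.1.ne']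
  field_simp
  ring

/-- The entropy `σ` is strictly concave on the open convex set
`D = {(ρ, m, E) : ρ > 0 and E > |m|²/(2ρ)}`. -/
theorem entropyCons_strictConcaveOn (d : ℕ) (hd : 1 ≤ d) (γ : ℝ) (hγ : 1 < γ)
    (x y : ℝ × EuclideanSpace ℝ (Fin d) × ℝ)
    (hx : 0 < x.1 ∧ ‖x.2.1‖ ^ 2 / (2 * x.1) < x.2.2)
    (hy : 0 < y.1 ∧ ‖y.2.1‖ ^ 2 / (2 * y.1) < y.2.2)
    (hxy : x ≠ y) (t : ℝ) (ht0 : 0 < t) (ht1 : t < 1) :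
    t * entropyCons d γ x + (1 - t) * entropyCons d γ y
      < entropyCons d γ (t • x + (1 - t) • y) := by
  obtain ⟨a, u, E⟩ := x
  obtain ⟨b, v, F⟩ := y
  have hs : 0 < 1 - t := sub_pos.2 ht1
  have hts : t + (1 - t) = 1 := by ring
  generalize 1 - t = s at hs hts ⊢
  have ha : 0 < a := hx.1
  have hb : 0 < b := hy.1
  have hc : 0 < t * a + s * b := by positivity
  have hdef := kineticEnergy_convexity_deficit u v ha hb ht0 hs
  obtain ⟨e, he⟩ : ∃ e, e = E - ‖u‖ ^ 2 / (2 * a) := ⟨_, rfl⟩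
  obtain ⟨f, hf⟩ : ∃ f, f = F - ‖v‖ ^ 2 / (2 * b) := ⟨_, rfl⟩
  obtain ⟨g, hg⟩ : ∃ g, g = t * E + s * F - ‖t • u + s • v‖ ^ 2 / (2 * (t * a + s * b)) :=
    ⟨_, rfl⟩
  have he0 : 0 < e := he ▸ sub_pos.2 hx.2
  have hf0 : 0 < f := hf ▸ sub_pos.2 hy.2
  have hgeq : g = t * e + s * f
      + t * s * ‖b • u - a • v‖ ^ 2 / (2 * a * b * (t * a + s * b)) := by
    rw [← hdef, he, hf, hg]; ring
  have hge : t * e + s * f ≤ g := by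
    rw [hgeq]; exact le_add_of_nonneg_right (by positivity)
  have hef0 : 0 < t * e + s * f := by positivity
  have hg0 : 0 < g := hef0.trans_le hge
  have hz : 0 < t * a + s * b ∧
      ‖t • u + s • v‖ ^ 2 / (2 * (t * a + s * b)) < t * E + s * F :=
    ⟨hc, sub_pos.1 (hg ▸ hg0)⟩
  rw [entropyCons_eq hγ hx, entropyCons_eq hγ hy,
    entropyCons_eq (x := t • (a, u, E) + s • (b, v, F)) hγ hz]
  simp only [Prod.fst_add, Prod.snd_add, Prod.smul_fst, Prod.smul_snd, smul_eq_mul]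
  rw [← he, ← hf, ← hg]
  have hk : 0 < (γ - 1)⁻¹ := inv_pos.2 (sub_pos.2 hγ)
  have hpersp := mul_log_div_add_le ha hb he0 hf0 ht0 hs
  have hmono : (t * a + s * b) * log ((t * e + s * f) / (t * a + s * b))
      ≤ (t * a + s * b) * log (g / (t * a + s * b)) := by gcongr
  have hconv : (t * a + s * b) * log (t * a + s * b) ≤ t * (a * log a) + s * (b * log b) :=
    strictConvexOn_mul_log.convexOn.2 (Set.mem_Ici.2 ha.le) (Set.mem_Ici.2 hb.le) ht0.le hs.le hts
  suffices h : t * (a * log (e / a)) + s * (b * log (f / b))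
        < (t * a + s * b) * log (g / (t * a + s * b)) ∨
      (t * a + s * b) * log (t * a + s * b) < t * (a * log a) + s * (b * log b) by
    rcases h with h | h
    · linarith [mul_lt_mul_of_pos_left h hk]
    · linarith [mul_le_mul_of_nonneg_left (hpersp.trans hmono) hk.le]
  by_cases hab : a = b
  · left
    subst hab
    have hca : t * a + s * a = a := by rw [← add_mul, hts, one_mul]
    by_cases hef : e = f
    · subst hef
      have huv : u ≠ v := by
        rintro rfl
        exact hxy (by rw [show E = F by linarith])
      have hlt : t * e + s * e < g := by
        have : 0 < ‖a • u - a • v‖ := by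
          rw [← smul_sub, norm_pos_iff]
          exact smul_ne_zero ha.ne' (sub_ne_zero.2 huv)
        rw [hgeq]
        exact lt_add_of_pos_right _ (by positivity)
      refine hpersp.trans_lt ?_
      gcongr
    · refine lt_of_lt_of_le ?_ hmono
      have h := strictConcaveOn_log_Ioi.2 (Set.mem_Ioi.2 (div_pos he0 ha))
        (Set.mem_Ioi.2 (div_pos hf0 ha)) (fun h => hef ((div_left_inj' ha.ne').1 h)) ht0 hs hts
      simp only [smul_eq_mul, ← mul_div_assoc, ← add_div] at h
      rw [hca]
      linarith [mul_lt_mul_of_pos_left h ha]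
  · exact .inr <| strictConvexOn_mul_log.2 (Set.mem_Ici.2 ha.le) (Set.mem_Ici.2 hb.le) hab ht0 hs hts
end

section
/- The extended entropy Σ : ℝ × ℝ^d × ℝ → [−∞, ∞), defined by Σ(ρ, m, E) = c_v ρ log((γ−1)(E − |m|²/(2ρ)) ρ^{−γ}) if ρ > 0 and E > |m|²/(2ρ), Σ(ρ, m, E) = 0 if ρ = 0, m = 0 and E ≥ 0, and Σ(ρ, m, E) = −∞ otherwise, is concave and upper semicontinuous on ℝ × ℝ^d × ℝ. -/
open Real

open scoped Classical

/-- The extended entropy `Σ : ℝ × ℝ^d × ℝ → [−∞, ∞)` of the polytropic Euler system in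
conservative variables: `Σ(ρ, m, E) = c_v ρ log((γ−1)(E − |m|²/(2ρ)) ρ^{−γ})` on
`D = {ρ > 0, E > |m|²/(2ρ)}`, `0` on the vacuum states `{ρ = 0, m = 0, E ≥ 0}`, and
`−∞` elsewhere, with `c_v = 1/(γ−1)`. -/
noncomputable def entropyExt (d : ℕ) (γ : ℝ) (x : ℝ × EuclideanSpace ℝ (Fin d) × ℝ) : EReal :=
  if 0 < x.1 ∧ ‖x.2.1‖ ^ 2 / (2 * x.1) < x.2.2 then
    (((γ - 1)⁻¹ * x.1 * Real.log ((γ - 1) * (x.2.2 - ‖x.2.1‖ ^ 2 / (2 * x.1)) * x.1 ^ (-γ)) : ℝ) :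
      EReal)
  else if x.1 = 0 ∧ x.2.1 = 0 ∧ 0 ≤ x.2.2 then 0
  else ⊥

/-- The affine functions whose pointwise infimum is the extended entropy, indexed by `a, b > 0` and
`u ∈ ℝ^d`. -/
noncomputable def entropyTangent (d : ℕ) (γ a b : ℝ) (u : EuclideanSpace ℝ (Fin d))
    (x : ℝ × EuclideanSpace ℝ (Fin d) × ℝ) : ℝ :=
  a * (x.2.2 - inner ℝ u x.2.1 + x.1 * ‖u‖ ^ 2 / 2) - (γ - 1)⁻¹ * x.1 * (1 + Real.log a)
    + b - x.1 * (1 + Real.log b)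

theorem continuous_entropyTangent (d : ℕ) (γ a b : ℝ) (u : EuclideanSpace ℝ (Fin d)) :
    Continuous (entropyTangent d γ a b u) := by
  unfold entropyTangent
  fun_prop

theorem entropyTangent_convexComb (d : ℕ) (γ a b : ℝ) (u : EuclideanSpace ℝ (Fin d))
    (x y : ℝ × EuclideanSpace ℝ (Fin d) × ℝ) (t : ℝ) :
    entropyTangent d γ a b u (t • x + (1 - t) • y)
      = t * entropyTangent d γ a b u x + (1 - t) * entropyTangent d γ a b u y := by
  simp only [entropyTangent, Prod.fst_add, Prod.snd_add, Prod.smul_fst, Prod.smul_snd,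
    inner_add_right, inner_smul_right, smul_eq_mul]
  ring

theorem mul_log_entropy_eq {γ ρ e : ℝ} (hγ : 1 < γ) (hρ : 0 < ρ) (he : 0 < e) :
    (γ - 1)⁻¹ * ρ * Real.log ((γ - 1) * e * ρ ^ (-γ))
      = (γ - 1)⁻¹ * ρ * Real.log ((γ - 1) * e / ρ) - ρ * Real.log ρ := by
  have h : 0 < γ - 1 := sub_pos.2 hγ
  have hp : 0 < (γ - 1) * e := mul_pos h he
  rw [Real.log_mul hp.ne' (Real.rpow_pos_of_pos hρ _).ne', Real.log_rpow hρ,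
    Real.log_div hp.ne' hρ.ne']
  field_simp
  ring

theorem mul_log_div_le {p ρ a : ℝ} (hp : 0 < p) (hρ : 0 < ρ) (ha : 0 < a) :
    ρ * Real.log (p / ρ) ≤ a * p - ρ * (1 + Real.log a) := by
  have h := Real.log_le_sub_one_of_pos (show 0 < a * (p / ρ) by positivity)
  rw [Real.log_mul ha.ne' (by positivity)] at h
  have h' := mul_le_mul_of_nonneg_left h hρ.le
  have e : ρ * (a * (p / ρ) - 1) = a * p - ρ := by field_simp
  rw [e] at h'
  linarith

theorem sub_norm_sq_div_le {F : Type*} [NormedAddCommGroup F] [InnerProductSpace ℝ F] (u m : F)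
    {ρ : ℝ} (hρ : 0 < ρ) (E : ℝ) :
    E - ‖m‖ ^ 2 / (2 * ρ) ≤ E - inner ℝ u m + ρ * ‖u‖ ^ 2 / 2 := by
  have h := norm_sub_sq_real (ρ • u) m
  rw [norm_smul, Real.norm_of_nonneg hρ.le, real_inner_smul_left] at h
  have h0 : 0 ≤ ‖ρ • u - m‖ ^ 2 / (2 * ρ) := by positivity
  have e : ‖ρ • u - m‖ ^ 2 / (2 * ρ)
      = ‖m‖ ^ 2 / (2 * ρ) - inner ℝ u m + ρ * ‖u‖ ^ 2 / 2 := by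
    rw [h]; field_simp; ring
  linarith

theorem sub_inner_inv_smul_self {F : Type*} [NormedAddCommGroup F] [InnerProductSpace ℝ F] (m : F)
    {ρ : ℝ} (hρ : 0 < ρ) (E : ℝ) :
    E - inner ℝ (ρ⁻¹ • m) m + ρ * ‖ρ⁻¹ • m‖ ^ 2 / 2 = E - ‖m‖ ^ 2 / (2 * ρ) := by
  rw [norm_smul, Real.norm_of_nonneg (inv_pos.2 hρ).le, real_inner_smul_left,
    real_inner_self_eq_norm_sq]
  field_simp
  ring

theorem entropyExt_le_entropyTangent {d : ℕ} {γ a b : ℝ} (hγ : 1 < γ) (ha : 0 < a) (hb : 0 < b)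
    (u : EuclideanSpace ℝ (Fin d)) (x : ℝ × EuclideanSpace ℝ (Fin d) × ℝ) :
    entropyExt d γ x ≤ (entropyTangent d γ a b u x : ℝ) := by
  obtain ⟨ρ, m, E⟩ := x
  unfold entropyExt entropyTangent
  dsimp only
  split_ifs with hD hV
  · obtain ⟨hρ, hE⟩ := hD
    have hc : 0 < γ - 1 := sub_pos.2 hγ
    have he := sub_pos.2 hE
    rw [EReal.coe_le_coe_iff, mul_log_entropy_eq hγ hρ he]
    have h1 := mul_le_mul_of_nonneg_left (mul_log_div_le (mul_pos hc he) hρ ha)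
      (inv_pos.2 hc).le
    have h2 := mul_log_div_le one_pos hρ hb
    have h3 := mul_le_mul_of_nonneg_left (sub_norm_sq_div_le u m hρ E) ha.le
    rw [one_div, Real.log_inv] at h2
    have e : (γ - 1)⁻¹ * (a * ((γ - 1) * (E - ‖m‖ ^ 2 / (2 * ρ))) - ρ * (1 + Real.log a))
        = a * (E - ‖m‖ ^ 2 / (2 * ρ)) - (γ - 1)⁻¹ * ρ * (1 + Real.log a) := by
      field_simp
    linarith
  · obtain ⟨rfl, rfl, hE⟩ := hV
    rw [← EReal.coe_zero, EReal.coe_le_coe_iff]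
    simp only [inner_zero_right]
    have := mul_nonneg ha.le hE
    linarith
  · exact bot_le

theorem exists_entropyTangent_lt {d : ℕ} {γ c : ℝ} (hγ : 1 < γ)
    {x : ℝ × EuclideanSpace ℝ (Fin d) × ℝ} (hx : entropyExt d γ x < c) :
    ∃ a b : ℝ, ∃ u : EuclideanSpace ℝ (Fin d), 0 < a ∧ 0 < b ∧ entropyTangent d γ a b u x < c := by
  obtain ⟨ρ, m, E⟩ := x
  have hc : 0 < γ - 1 := sub_pos.2 hγ
  unfold entropyExt at hx
  unfold entropyTangent
  dsimp only at hx ⊢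
  split_ifs at hx with hD hV
  · obtain ⟨hρ, hE⟩ := hD
    have he := sub_pos.2 hE
    rw [EReal.coe_lt_coe_iff, mul_log_entropy_eq hγ hρ he] at hx
    refine ⟨ρ / ((γ - 1) * (E - ‖m‖ ^ 2 / (2 * ρ))), ρ, ρ⁻¹ • m, by positivity, hρ, ?_⟩
    rw [sub_inner_inv_smul_self m hρ]
    rw [← inv_div, Real.log_inv] at hx
    have e : ρ / ((γ - 1) * (E - ‖m‖ ^ 2 / (2 * ρ))) * (E - ‖m‖ ^ 2 / (2 * ρ))
        = (γ - 1)⁻¹ * ρ := by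
      generalize E - ‖m‖ ^ 2 / (2 * ρ) = e at he
      field_simp
    rw [e]
    linarith
  · obtain ⟨rfl, rfl, hE⟩ := hV
    have hx : 0 < c := by exact_mod_cast hx
    refine ⟨c / (2 * (E + 1)), c / 2, 0, by positivity, by positivity, ?_⟩
    have e : c / (2 * (E + 1)) * E < c / 2 := by
      rw [div_mul_eq_mul_div, div_lt_div_iff₀ (by positivity) two_pos]
      nlinarith
    simp only [inner_zero_right]
    linarith
  · rcases lt_trichotomy ρ 0 with hρ | rfl | hρ
    · obtain ⟨s, hs⟩ := exists_gt (max 0 ((E - (γ - 1)⁻¹ * ρ + 1 - ρ - c) / (-ρ)))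
      obtain ⟨hs0, hs⟩ := max_lt_iff.1 hs
      rw [div_lt_iff₀ (by linarith)] at hs
      refine ⟨1, Real.exp (-s), 0, one_pos, Real.exp_pos _, ?_⟩
      have := Real.exp_lt_one_iff.2 (neg_lt_zero.2 hs0)
      simp only [inner_zero_left, norm_zero, Real.log_one, Real.log_exp]
      linarith
    · by_cases hm : m = 0
      · subst hm
        have hE : E < 0 := by
          by_contra h
          exact hV ⟨rfl, rfl, not_lt.1 h⟩
        obtain ⟨s, hs⟩ := exists_gt (max 0 ((1 - c) / (-E)))
        obtain ⟨hs0, hs⟩ := max_lt_iff.1 hs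
        rw [div_lt_iff₀ (by linarith)] at hs
        refine ⟨s, 1, 0, hs0, one_pos, ?_⟩
        simp only [inner_zero_right]
        linarith
      · have hm' : 0 < ‖m‖ ^ 2 := by positivity
        obtain ⟨s, hs⟩ := exists_gt ((E + 1 - c) / ‖m‖ ^ 2)
        rw [div_lt_iff₀ hm'] at hs
        refine ⟨1, 1, s • m, one_pos, one_pos, ?_⟩
        rw [real_inner_smul_left, real_inner_self_eq_norm_sq]
        linarith
    · have hE : E - ‖m‖ ^ 2 / (2 * ρ) ≤ 0 := by
        by_contra h
        exact hD ⟨hρ, sub_pos.1 (not_le.1 h)⟩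
      have hk : 0 < (γ - 1)⁻¹ * ρ := by positivity
      obtain ⟨s, hs⟩ := exists_gt ((1 - ρ - c) / ((γ - 1)⁻¹ * ρ))
      rw [div_lt_iff₀ hk] at hs
      refine ⟨Real.exp s, 1, ρ⁻¹ • m, Real.exp_pos _, one_pos, ?_⟩
      rw [sub_inner_inv_smul_self m hρ, Real.log_exp, Real.log_one]
      have := mul_nonpos_of_nonneg_of_nonpos (Real.exp_pos s).le hE
      linarith

/-- The extended entropy `Σ` is concave and upper semicontinuous on `ℝ × ℝ^d × ℝ`. -/
theorem entropyExt_concave_upperSemicontinuous (d : ℕ) (hd : 1 ≤ d) (γ : ℝ) (hγ : 1 < γ) :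
    (∀ x y : ℝ × EuclideanSpace ℝ (Fin d) × ℝ, ∀ t : ℝ, 0 ≤ t → t ≤ 1 →
      (t : EReal) * entropyExt d γ x + ((1 - t : ℝ) : EReal) * entropyExt d γ y
        ≤ entropyExt d γ (t • x + (1 - t) • y)) ∧
    UpperSemicontinuous (entropyExt d γ) := by
  refine ⟨fun x y t ht0 ht1 => ?_, fun x z hz => ?_⟩
  · refine EReal.le_of_forall_lt_iff_le.1 fun c hc => ?_
    obtain ⟨a, b, u, ha, hb, h⟩ := exists_entropyTangent_lt hγ hc
    rw [entropyTangent_convexComb] at h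
    have ht : (0 : EReal) ≤ t := by exact_mod_cast ht0
    have ht' : (0 : EReal) ≤ ((1 - t : ℝ) : EReal) := by exact_mod_cast sub_nonneg.2 ht1
    calc _ ≤ (t : EReal) * (entropyTangent d γ a b u x : ℝ)
          + ((1 - t : ℝ) : EReal) * (entropyTangent d γ a b u y : ℝ) :=
          add_le_add
            (mul_le_mul_of_nonneg_left (entropyExt_le_entropyTangent hγ ha hb u x) ht)
            (mul_le_mul_of_nonneg_left (entropyExt_le_entropyTangent hγ ha hb u y) ht')
      _ ≤ c := by exact_mod_cast h.le
  · obtain ⟨c, hxc, hcz⟩ := EReal.lt_iff_exists_real_btwn.1 hz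
    obtain ⟨a, b, u, ha, hb, h⟩ := exists_entropyTangent_lt hγ hxc
    filter_upwards [(continuous_entropyTangent d γ a b u).continuousAt.eventually_lt_const h]
      with y hy
    exact (entropyExt_le_entropyTangent hγ ha hb u y).trans_lt
      ((EReal.coe_lt_coe_iff.2 hy).trans hcz)
end

section
/- (Saturated entropy Jensen inequality forces a Dirac measure.) Let ν be a Borel probability measure on ℝ × ℝ^d × ℝ giving full measure to D, and assume the coordinate functions (ρ, m, E) ↦ ρ, m, E and the entropy (ρ, m, E) ↦ σ(ρ, m, E) are ν-integrable. Set ρ̄ = ∫ ρ dν, m̄ = ∫ m dν, Ē = ∫ E dν. Then (ρ̄, m̄, Ē) ∈ D, the Jensen inequality ∫ σ dν ≤ σ(ρ̄, m̄, Ē) holds, and if moreover ∫ σ dν ≥ σ(ρ̄, m̄, Ē), then ν is the Dirac measure concentrated at (ρ̄, m̄, Ē). -/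
open Real MeasureTheory

open scoped InnerProductSpace

/-- The internal energy lies below its tangent hyperplane with velocity `u`; the gap is the
kinetic energy relative to `u`. -/
theorem internalEnergy_eq_tangent_sub {V : Type*} [NormedAddCommGroup V]
    [InnerProductSpace ℝ V] {ρ : ℝ} (hρ : 0 < ρ) (m u : V) (E : ℝ) :
    E - ‖m‖ ^ 2 / (2 * ρ) =
      E - ⟪u, m⟫_ℝ + ρ * (‖u‖ ^ 2 / 2) - ‖m - ρ • u‖ ^ 2 / (2 * ρ) := by
  rw [norm_sub_sq_real, inner_smul_right, norm_smul, real_inner_comm, Real.norm_of_nonneg hρ.le]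
  field_simp
  ring

/-- The tangent inequality for `(ρ, e) ↦ c ρ log ((γ - 1) e ρ ^ (-γ))` at `(ρ₀, e₀)`, with its
defect. -/
theorem exists_entropy_defect {γ ρ e ρ₀ e₀ : ℝ} (hγ : 1 < γ) (hρ : 0 < ρ) (he : 0 < e)
    (hρ₀ : 0 < ρ₀) (he₀ : 0 < e₀) :
    ∃ δ : ℝ, 0 ≤ δ ∧ (δ = 0 → ρ = ρ₀ ∧ e = e₀) ∧
      (γ - 1)⁻¹ * ρ * Real.log ((γ - 1) * e * ρ ^ (-γ)) =
        (γ - 1)⁻¹ * Real.log ((γ - 1) * e₀ * ρ₀ ^ (-γ)) * ρ +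
          (γ - 1)⁻¹ * (ρ₀ / e₀) * e - (γ - 1)⁻¹ * ρ + ρ₀ - ρ - δ := by
  have hγ' : 0 < γ - 1 := sub_pos.2 hγ
  have hc : 0 < (γ - 1)⁻¹ := inv_pos.2 hγ'
  have hx : 0 < e * ρ₀ / (e₀ * ρ) := by positivity
  have hy : 0 < ρ₀ / ρ := by positivity
  have hx1 : 0 ≤ e * ρ₀ / (e₀ * ρ) - 1 - Real.log (e * ρ₀ / (e₀ * ρ)) := by
    linarith [Real.log_le_sub_one_of_pos hx]
  have hy1 : 0 ≤ ρ₀ / ρ - 1 - Real.log (ρ₀ / ρ) := by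
    linarith [Real.log_le_sub_one_of_pos hy]
  have hδx := mul_nonneg (mul_nonneg hc.le hρ.le) hx1
  have hδy := mul_nonneg hρ.le hy1
  refine ⟨(γ - 1)⁻¹ * ρ * (e * ρ₀ / (e₀ * ρ) - 1 - Real.log (e * ρ₀ / (e₀ * ρ))) +
    ρ * (ρ₀ / ρ - 1 - Real.log (ρ₀ / ρ)), add_nonneg hδx hδy, fun h => ?_, ?_⟩
  · have hy0 : ρ₀ / ρ = 1 := by
      by_contra hne
      have := Real.log_lt_sub_one_of_pos hy hne
      have := mul_pos hρ (show 0 < ρ₀ / ρ - 1 - Real.log (ρ₀ / ρ) by linarith)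
      linarith
    have hx0 : e * ρ₀ / (e₀ * ρ) = 1 := by
      by_contra hne
      have := Real.log_lt_sub_one_of_pos hx hne
      have := mul_pos (mul_pos hc hρ)
        (show 0 < e * ρ₀ / (e₀ * ρ) - 1 - Real.log (e * ρ₀ / (e₀ * ρ)) by linarith)
      linarith
    rw [div_eq_one_iff_eq hρ.ne'] at hy0
    rw [div_eq_one_iff_eq (by positivity), hy0] at hx0
    exact ⟨hy0.symm, mul_right_cancel₀ hρ.ne' hx0⟩
  · have hlog : ∀ {r a : ℝ}, 0 < r → 0 < a →
        Real.log ((γ - 1) * a * r ^ (-γ)) = Real.log (γ - 1) + Real.log a - γ * Real.log r := by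
      intro r a hr ha
      rw [Real.log_mul (by positivity) (by positivity), Real.log_mul hγ'.ne' ha.ne',
        Real.log_rpow hr]
      ring
    rw [hlog hρ he, hlog hρ₀ he₀, Real.log_div (by positivity) (by positivity),
      Real.log_mul he.ne' hρ₀.ne', Real.log_mul he₀.ne' hρ.ne', Real.log_div hρ₀.ne' hρ.ne']
    field_simp
    ring

/-- The entropy lies below an affine function touching it at `(ρ₀, m₀, E₀)` only. -/
theorem exists_entropyCons_defect {d : ℕ} {γ : ℝ} (hγ : 1 < γ)
    {p q : ℝ × EuclideanSpace ℝ (Fin d) × ℝ}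
    (hp : 0 < p.1) (hpE : ‖p.2.1‖ ^ 2 / (2 * p.1) < p.2.2)
    (hq : 0 < q.1) (hqE : ‖q.2.1‖ ^ 2 / (2 * q.1) < q.2.2) :
    ∃ δ : ℝ, 0 ≤ δ ∧ (δ = 0 → p = q) ∧
      entropyCons d γ p =
        (γ - 1)⁻¹ * Real.log ((γ - 1) * (q.2.2 - ‖q.2.1‖ ^ 2 / (2 * q.1)) * q.1 ^ (-γ)) * p.1 +
          (γ - 1)⁻¹ * (q.1 / (q.2.2 - ‖q.2.1‖ ^ 2 / (2 * q.1))) *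
            (p.2.2 - ⟪q.1⁻¹ • q.2.1, p.2.1⟫_ℝ + p.1 * (‖q.1⁻¹ • q.2.1‖ ^ 2 / 2)) -
          (γ - 1)⁻¹ * p.1 + q.1 - p.1 - δ := by
  have hγ' : 0 < γ - 1 := sub_pos.2 hγ
  have he₀ := sub_pos.2 hqE
  obtain ⟨δ, hδ, hδ0, h⟩ := exists_entropy_defect hγ hp (sub_pos.2 hpE) hq he₀
  set K := (γ - 1)⁻¹ * (q.1 / (q.2.2 - ‖q.2.1‖ ^ 2 / (2 * q.1)))
  have hKpos : 0 < K := by positivity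
  have htan := internalEnergy_eq_tangent_sub hp p.2.1 (q.1⁻¹ • q.2.1) p.2.2
  have hgap : 0 ≤ K * (‖p.2.1 - p.1 • q.1⁻¹ • q.2.1‖ ^ 2 / (2 * p.1)) := by positivity
  refine ⟨δ + K * (‖p.2.1 - p.1 • q.1⁻¹ • q.2.1‖ ^ 2 / (2 * p.1)), add_nonneg hδ hgap,
    fun h0 => ?_, ?_⟩
  · obtain ⟨hρ, he⟩ := hδ0 (by linarith)
    have hz : ‖p.2.1 - p.1 • q.1⁻¹ • q.2.1‖ ^ 2 / (2 * p.1) = 0 :=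
      (mul_eq_zero.1 (show K * _ = 0 by linarith)).resolve_left hKpos.ne'
    have hz' : p.2.1 - p.1 • q.1⁻¹ • q.2.1 = 0 := by
      rcases div_eq_zero_iff.1 hz with h | h
      · exact norm_eq_zero.1 (pow_eq_zero_iff two_ne_zero |>.1 h)
      · linarith
    have hm : p.2.1 = q.2.1 := by
      rw [sub_eq_zero.1 hz', hρ, smul_inv_smul₀ hq.ne']
    rw [hρ, hm] at he
    exact Prod.ext hρ (Prod.ext hm (by linarith))
  · rw [entropyCons, h, htan]
    ring

theorem MeasureTheory.Measure.eq_dirac_of_ae_eq {α : Type*} [MeasurableSpace α] {μ : Measure α}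
    [IsProbabilityMeasure μ] {a : α} (h : ∀ᵐ x ∂μ, x = a) : μ = Measure.dirac a := by
  have h' : (id : α → α) =ᵐ[μ] fun _ => a := h
  rw [← Measure.map_id (μ := μ), Measure.map_congr h', Measure.map_const]
  simp

theorem MeasureTheory.integral_pos_of_ae_pos {α : Type*} [MeasurableSpace α] {μ : Measure α}
    [NeZero μ] {f : α → ℝ} (hf : Integrable f μ) (h : ∀ᵐ x ∂μ, 0 < f x) :
    0 < ∫ x, f x ∂μ := by
  have h0 : 0 ≤ᵐ[μ] f := h.mono fun _ hx => hx.le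
  refine (integral_nonneg_of_ae h0).lt_of_ne fun hz => ?_
  obtain ⟨x, hx, hx0⟩ := (h.and ((integral_eq_zero_iff_of_nonneg_ae h0 hf).1 hz.symm)).exists
  exact hx.ne' hx0

/-- Saturated entropy Jensen inequality forces a Dirac measure: if `ν` is a probability
measure concentrated on `D = {(ρ, m, E) : ρ > 0, E > |m|²/(2ρ)}` with integrable
coordinates and integrable entropy, then the barycenter `(ρ̄, m̄, Ē)` lies in `D`,
Jensen's inequality `∫ σ dν ≤ σ(ρ̄, m̄, Ē)` holds, and its saturation forces `ν` to be
the Dirac mass at `(ρ̄, m̄, Ē)`. -/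
theorem entropy_jensen_saturated_dirac (d : ℕ) (hd : 1 ≤ d) (γ : ℝ) (hγ : 1 < γ)
    (ν : Measure (ℝ × EuclideanSpace ℝ (Fin d) × ℝ)) [IsProbabilityMeasure ν]
    (hD : ν {p | 0 < p.1 ∧ ‖p.2.1‖ ^ 2 / (2 * p.1) < p.2.2} = 1)
    (hρ : Integrable (fun p => p.1) ν)
    (hm : Integrable (fun p => p.2.1) ν)
    (hE : Integrable (fun p => p.2.2) ν)
    (hσ : Integrable (entropyCons d γ) ν) :
    (0 < ∫ p, p.1 ∂ν ∧
      ‖∫ p, p.2.1 ∂ν‖ ^ 2 / (2 * ∫ p, p.1 ∂ν) < ∫ p, p.2.2 ∂ν) ∧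
    ∫ p, entropyCons d γ p ∂ν ≤ entropyCons d γ (∫ p, p.1 ∂ν, ∫ p, p.2.1 ∂ν, ∫ p, p.2.2 ∂ν) ∧
    (entropyCons d γ (∫ p, p.1 ∂ν, ∫ p, p.2.1 ∂ν, ∫ p, p.2.2 ∂ν) ≤ ∫ p, entropyCons d γ p ∂ν →
      ν = Measure.dirac (∫ p, p.1 ∂ν, ∫ p, p.2.1 ∂ν, ∫ p, p.2.2 ∂ν)) := by
  have hae : ∀ᵐ p ∂ν, 0 < p.1 ∧ ‖p.2.1‖ ^ 2 / (2 * p.1) < p.2.2 := by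
    refine (prob_compl_eq_zero_iff ?_).2 hD
    exact measurableSet_setOfPred.2 <| .and (measurableSet_setOfPred.1 <| measurableSet_lt
      (by fun_prop) (by fun_prop)) (measurableSet_setOfPred.1 <| measurableSet_lt
      (by fun_prop) (by fun_prop))
  have hρpos : 0 < ∫ p, p.1 ∂ν := integral_pos_of_ae_pos hρ (hae.mono fun p hp => hp.1)
  set ρ₀ := ∫ p, p.1 ∂ν with hρ₀
  set m₀ := ∫ p, p.2.1 ∂ν with hm₀
  set E₀ := ∫ p, p.2.2 ∂ν with hE₀
  have hinner : Integrable (fun p => ⟪ρ₀⁻¹ • m₀, p.2.1⟫_ℝ) ν := hm.const_inner _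
  have hEi : Integrable (fun p => p.2.2 - ⟪ρ₀⁻¹ • m₀, p.2.1⟫_ℝ) ν := hE.sub hinner
  have hρi : Integrable (fun p => p.1 * (‖ρ₀⁻¹ • m₀‖ ^ 2 / 2)) ν := hρ.mul_const _
  have htan : Integrable (fun p => p.2.2 - ⟪ρ₀⁻¹ • m₀, p.2.1⟫_ℝ +
      p.1 * (‖ρ₀⁻¹ • m₀‖ ^ 2 / 2)) ν := hEi.add hρi
  have htan_int : ∫ p, (p.2.2 - ⟪ρ₀⁻¹ • m₀, p.2.1⟫_ℝ + p.1 * (‖ρ₀⁻¹ • m₀‖ ^ 2 / 2)) ∂ν =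
      E₀ - ‖m₀‖ ^ 2 / (2 * ρ₀) := by
    rw [integral_add hEi hρi, integral_sub hE hinner, integral_inner hm, integral_mul_const,
      ← hρ₀, ← hm₀, ← hE₀, internalEnergy_eq_tangent_sub hρpos m₀ (ρ₀⁻¹ • m₀),
      smul_inv_smul₀ hρpos.ne']
    simp
  have hepos : ‖m₀‖ ^ 2 / (2 * ρ₀) < E₀ := by
    rw [← sub_pos, ← htan_int]
    refine integral_pos_of_ae_pos htan (hae.mono fun p hp => ?_)
    have h1 := internalEnergy_eq_tangent_sub hp.1 p.2.1 (ρ₀⁻¹ • m₀) p.2.2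
    have h2 : 0 ≤ ‖p.2.1 - p.1 • ρ₀⁻¹ • m₀‖ ^ 2 / (2 * p.1) :=
      div_nonneg (sq_nonneg _) (by linarith [hp.1])
    linarith [hp.2]
  refine ⟨⟨hρpos, hepos⟩, ?_⟩
  set A := (γ - 1)⁻¹ * Real.log ((γ - 1) * (E₀ - ‖m₀‖ ^ 2 / (2 * ρ₀)) * ρ₀ ^ (-γ)) with hA
  set K := (γ - 1)⁻¹ * (ρ₀ / (E₀ - ‖m₀‖ ^ 2 / (2 * ρ₀))) with hK
  let L : ℝ × EuclideanSpace ℝ (Fin d) × ℝ → ℝ := fun p =>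
    A * p.1 + K * (p.2.2 - ⟪ρ₀⁻¹ • m₀, p.2.1⟫_ℝ + p.1 * (‖ρ₀⁻¹ • m₀‖ ^ 2 / 2)) -
      (γ - 1)⁻¹ * p.1 + ρ₀ - p.1
  have hL1 := (hρ.const_mul A).add (htan.const_mul K)
  have hL2 := hL1.sub (hρ.const_mul (γ - 1)⁻¹)
  have hL3 := hL2.add (integrable_const ρ₀)
  have hL : Integrable L ν := hL3.sub hρ
  have hL_int : ∫ p, L p ∂ν = entropyCons d γ (ρ₀, m₀, E₀) := by
    have hstep : ∫ p, L p ∂ν = A * ρ₀ + K * (E₀ - ‖m₀‖ ^ 2 / (2 * ρ₀)) -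
        (γ - 1)⁻¹ * ρ₀ + ρ₀ - ρ₀ := by
      refine (integral_sub hL3 hρ).trans ?_
      rw [integral_add' hL2 (integrable_const ρ₀), integral_sub' hL1 (hρ.const_mul _),
        integral_add' (hρ.const_mul A) (htan.const_mul K), integral_const_mul, integral_const_mul,
        integral_const_mul, htan_int]
      simp [← hρ₀]
    have he : E₀ - ‖m₀‖ ^ 2 / (2 * ρ₀) ≠ 0 := (sub_pos.2 hepos).ne'
    rw [hstep, hK, mul_assoc (γ - 1)⁻¹ _ (E₀ - _), div_mul_cancel₀ _ he, hA, entropyCons]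
    ring
  have hdefect : ∀ᵐ p ∂ν, 0 ≤ L p - entropyCons d γ p ∧
      (L p - entropyCons d γ p = 0 → p = (ρ₀, m₀, E₀)) := by
    filter_upwards [hae] with p hp
    obtain ⟨δ, hδ, hδ0, h⟩ :=
      exists_entropyCons_defect (q := (ρ₀, m₀, E₀)) hγ hp.1 hp.2 hρpos hepos
    have hLδ : L p - entropyCons d γ p = δ := by
      rw [h]
      exact sub_sub_cancel _ _
    rw [hLδ]
    exact ⟨hδ, hδ0⟩
  have hnonneg : 0 ≤ᵐ[ν] fun p => L p - entropyCons d γ p := hdefect.mono fun _ hp => hp.1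
  have hsub := integral_sub hL hσ
  rw [hL_int] at hsub
  have hint := integral_nonneg_of_ae hnonneg
  refine ⟨by linarith, fun hle => Measure.eq_dirac_of_ae_eq ?_⟩
  have hzero := (integral_eq_zero_iff_of_nonneg_ae hnonneg (hL.sub hσ)).1
    (le_antisymm (by linarith) hint)
  filter_upwards [hdefect, hzero] with p hp hp0 using hp.2 hp0
end
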